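/- Let u, v, α, β be words over an alphabet A such that |u| ≥ |v|, both uα and uβ are suffixes of v^i for some integer i ≥ 1, and |α| ≤ |β|. Then α is a prefix of β, and the word δ defined by β = αδ commutes with v, i.e., δv = vδ. -/

import Mathlib

namespace FreeMonoid

variable {A : Type*}

theorem exists_eq_mul_of_mul_eq_mul {a b c d : FreeMonoid A} (h : a * b = c * d)
    (hl : a.length ≤ c.length) : ∃ e, c = a * e ∧ b = e * d := by
  obtain ⟨e, he⟩ : a.toList <+: c.toList :=
    List.prefix_of_prefix_length_le ⟨b.toList, congrArg toList h⟩
      (List.prefix_append c.toList d.toList) hl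
  have hc : c = a * ofList e := he.symm
  exact ⟨ofList e, hc, mul_left_cancel (a := a) (by rw [h, hc, mul_assoc])⟩

theorem eq_of_mul_eq_mul_of_length_eq {a b c d : FreeMonoid A} (h : a * b = c * d)
    (hl : a.length = c.length) : a = c :=
  (List.append_inj (congrArg toList h) hl).1

/-- A factor of a power of `v` that is at least as long as `v` starts with a conjugate of `v`. -/
theorem semiconjBy_of_pow_eq {v t p q : FreeMonoid A} {i : ℕ} (h : v ^ i = t * (p * q))
    (hl : p.length = v.length) : SemiconjBy t p v := by
  refine eq_of_mul_eq_mul_of_length_eq (b := q * v) (d := p * q) ?_ ?_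
  · calc t * p * (q * v) = v ^ i * v := by rw [h]; simp only [mul_assoc]
      _ = v * v ^ i := pow_mul_comm' v i
      _ = v * t * (p * q) := by rw [h, mul_assoc]
  · rw [length_mul, length_mul, hl, add_comm]

end FreeMonoid

/-- If `|u| ≥ |v|`, `uα` and `uβ` are suffixes of `v^i` for some `i ≥ 1`, and
`|α| ≤ |β|`, then `α` is a prefix of `β` and `α⁻¹β` commutes with `v`. -/
theorem stmt15 {A : Type*} (u v α β : FreeMonoid A) (i : ℕ) (hi : 1 ≤ i)
    (hlen : v.length ≤ u.length)
    (hα : ∃ t, v ^ i = t * (u * α)) (hβ : ∃ t, v ^ i = t * (u * β))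
    (hαβ : α.length ≤ β.length) :
    ∃ δ : FreeMonoid A, β = α * δ ∧ δ * v = v * δ := by
  obtain ⟨t, ht⟩ := hα
  obtain ⟨s, hs⟩ := hβ
  obtain ⟨p, q, rfl, hp⟩ : ∃ p q, u = p * q ∧ p.length = v.length :=
    ⟨.ofList (u.toList.take v.length), .ofList (u.toList.drop v.length),
      (List.take_append_drop v.length u.toList).symm, List.length_take_of_le hlen⟩
  have htp : SemiconjBy t p v :=
    FreeMonoid.semiconjBy_of_pow_eq (by rw [ht, mul_assoc]) hp
  have hsp : SemiconjBy s p v :=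
    FreeMonoid.semiconjBy_of_pow_eq (by rw [hs, mul_assoc]) hp
  have hpt : p ^ i = p * q * α * t :=
    mul_left_cancel (a := t) (by rw [(htp.pow_right i).eq, ht]; simp only [mul_assoc])
  have hps : p ^ i = p * q * β * s :=
    mul_left_cancel (a := s) (by rw [(hsp.pow_right i).eq, hs]; simp only [mul_assoc])
  have h : α * t = β * s :=
    mul_left_cancel (a := p * q) (by rw [← mul_assoc, ← mul_assoc, ← hpt, hps])
  obtain ⟨δ, hδ, rfl⟩ := FreeMonoid.exists_eq_mul_of_mul_eq_mul h hαβ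
  refine ⟨δ, hδ, mul_right_cancel (b := s) ?_⟩
  rw [mul_assoc, ← hsp.eq, ← mul_assoc, htp.eq, mul_assoc]
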